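/- (Basic Addition Theorem) Let F, G be primitive subequations on an open set U ⊆ ℝⁿ (closed subsets of U × ℝ × ℝⁿ × Sym²(ℝⁿ) satisfying positivity), and let H be the closure of the fibrewise sum F + G = {(x, r+s, p+q, A+B) : (x,r,p,A) ∈ F, (x,s,q,B) ∈ G}. Then H is a primitive subequation, and if u, v are λ-quasi-convex on U with u F-subharmonic and v G-subharmonic, then u + v is H-subharmonic on U. -/

import Mathlib

open scoped RealInnerProductSpace Topology
open Filter MeasureTheory

/-- The quadratic form `⟨A v, v⟩` associated to a matrix `A`. -/
noncomputable def quad {n : ℕ} (A : Matrix (Fin n) (Fin n) ℝ)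
    (v : EuclideanSpace ℝ (Fin n)) : ℝ :=
  ∑ i, ∑ j, A i j * v i * v j

/-- `(p, A)` is an upper contact jet for `w` at `x₀`. -/
def UpperContactJet {n : ℕ} (w : EuclideanSpace ℝ (Fin n) → ℝ)
    (x₀ p : EuclideanSpace ℝ (Fin n)) (A : Matrix (Fin n) (Fin n) ℝ) : Prop :=
  ∀ᶠ y in 𝓝 x₀, w y ≤ w x₀ + ⟪p, y - x₀⟫ + (1 / 2) * quad A (y - x₀)

/-- `w` is twice differentiable at `x` with gradient `g` and Hessian `H`, in the sense of
a second-order Taylor expansion. -/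
def TwiceDiffAt {n : ℕ} (w : EuclideanSpace ℝ (Fin n) → ℝ)
    (x g : EuclideanSpace ℝ (Fin n)) (H : Matrix (Fin n) (Fin n) ℝ) : Prop :=
  HasGradientAt w g x ∧
    (fun y => w y - w x - ⟪g, y - x⟫ - (1 / 2) * quad H (y - x)) =o[𝓝 x]
      fun y => ‖y - x‖ ^ 2

/-- `w` is `lam`-quasi-convex on `U`: `w + (lam/2)|·|²` is convex on `U`. -/
def QCOn {n : ℕ} (lam : ℝ) (U : Set (EuclideanSpace ℝ (Fin n)))
    (w : EuclideanSpace ℝ (Fin n) → ℝ) : Prop :=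
  ConvexOn ℝ U (fun x => w x + (lam / 2) * ‖x‖ ^ 2)

/-- The 2-jet space `ℝⁿ × ℝ × ℝⁿ × Sym²(ℝⁿ)` (symmetry imposed separately). -/
abbrev Jet (n : ℕ) :=
  EuclideanSpace ℝ (Fin n) × ℝ × EuclideanSpace ℝ (Fin n) × Matrix (Fin n) (Fin n) ℝ

/-- Positivity condition (P) for a set of 2-jets. -/
def Positivity {n : ℕ} (F : Set (Jet n)) : Prop :=
  ∀ x : EuclideanSpace ℝ (Fin n), ∀ r : ℝ, ∀ p : EuclideanSpace ℝ (Fin n),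
    ∀ A P : Matrix (Fin n) (Fin n) ℝ,
      (x, r, p, A) ∈ F → P.PosSemidef → (x, r, p, A + P) ∈ F

/-- `u` is `F`-subharmonic on `U`: every upper contact jet of `u` at a point of `U`
belongs to `F`. -/
def Subharm {n : ℕ} (F : Set (Jet n)) (U : Set (EuclideanSpace ℝ (Fin n)))
    (u : EuclideanSpace ℝ (Fin n) → ℝ) : Prop :=
  ∀ x ∈ U, ∀ (p : EuclideanSpace ℝ (Fin n)) (A : Matrix (Fin n) (Fin n) ℝ),
    A.IsSymm → UpperContactJet u x p A → (x, u x, p, A) ∈ F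

section
variable {E : Type*} [NormedAddCommGroup E] [InnerProductSpace ℝ E]

theorem ConvexOn.exists_subgradient [FiniteDimensional ℝ E] {U : Set E} {φ : E → ℝ}
    (hφ : ConvexOn ℝ U φ) (hU : IsOpen U) {x : E} (hx : x ∈ U) :
    ∃ g : E, ∀ z ∈ U, φ x + ⟪g, z - x⟫ ≤ φ z := by
  have hopen : IsOpen {q : E × ℝ | q.1 ∈ U ∧ φ q.1 < q.2} := by
    have hc : ContinuousOn (fun q : E × ℝ => q.2 - φ q.1) (Prod.fst ⁻¹' U) :=
      continuous_snd.continuousOn.sub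
        ((hφ.continuousOn hU).comp continuous_fst.continuousOn fun q hq => hq)
    convert hc.isOpen_inter_preimage (hU.preimage continuous_fst) (isOpen_Ioi (a := (0 : ℝ)))
      using 1
    ext q
    simp
  obtain ⟨f, hf⟩ := geometric_hahn_banach_open_point (x := (x, φ x))
    hφ.convex_strict_epigraph hopen (by simp)
  have hsplit : ∀ (z : E) (t : ℝ), f (z, t) = f (z, 0) + t * f (0, 1) := by
    intro z t
    rw [← smul_eq_mul, ← map_smul, ← map_add]
    simp
  set c := f (0, 1) with hc
  have hc0 : c < 0 := by
    have h := hf (x, φ x + 1) ⟨hx, by simp⟩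
    rw [hsplit, hsplit x (φ x)] at h
    linarith
  have hle : ∀ z ∈ U, f (z, 0) + φ z * c ≤ f (x, 0) + φ x * c := by
    intro z hz
    have ht : Tendsto (fun t : ℝ => f (z, 0) + t * c) (𝓝[>] (φ z)) (𝓝 (f (z, 0) + φ z * c)) :=
      Continuous.continuousWithinAt (by fun_prop)
    refine le_of_tendsto ht ?_
    filter_upwards [self_mem_nhdsWithin] with t ht
    have h := hf (z, t) ⟨hz, ht⟩
    rw [hsplit, hsplit x (φ x)] at h
    exact h.le
  refine ⟨(InnerProductSpace.toDual ℝ E).symm ((-c)⁻¹ • f.comp (ContinuousLinearMap.inl ℝ E ℝ)),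
    fun z hz => ?_⟩
  have h := hle z hz
  have h2 : f (z - x, 0) = f (z, 0) - f (x, 0) := by rw [← map_sub]; simp
  rw [InnerProductSpace.toDual_symm_apply]
  simp only [_root_.smul_apply, ContinuousLinearMap.comp_apply,
    ContinuousLinearMap.inl_apply, smul_eq_mul, h2]
  have h3 : (-c)⁻¹ * (f (z, 0) - f (x, 0)) ≤ φ z - φ x := by
    rw [inv_mul_le_iff₀ (by linarith)]
    linarith
  linarith

/-- At every point, a semiconvex function is touched from below by a paraboloid. -/
theorem ConvexOn.exists_lower_paraboloid [FiniteDimensional ℝ E] {U : Set E} {w : E → ℝ} {lam : ℝ}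
    (hw : ConvexOn ℝ U fun x => w x + lam / 2 * ‖x‖ ^ 2) (hU : IsOpen U) :
    ∃ g : E → E, ∀ y ∈ U, ∀ z ∈ U, w y + ⟪g y, z - y⟫ - lam / 2 * ‖z - y‖ ^ 2 ≤ w z := by
  have h : ∀ y, ∃ a : E, y ∈ U → ∀ z ∈ U, w y + ⟪a, z - y⟫ - lam / 2 * ‖z - y‖ ^ 2 ≤ w z := by
    intro y
    by_cases hy : y ∈ U
    · obtain ⟨a, ha⟩ := hw.exists_subgradient hU hy
      refine ⟨a - lam • y, fun _ z hz => ?_⟩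
      have h1 := ha z hz
      have h2 : ‖z‖ ^ 2 = ‖y‖ ^ 2 + 2 * ⟪y, z - y⟫ + ‖z - y‖ ^ 2 := by
        rw [← norm_add_sq_real]
        simp
      rw [inner_sub_left, real_inner_smul_left]
      rw [h2] at h1
      linarith
    · exact ⟨0, fun h => absurd h hy⟩
  choose g hg using h
  exact ⟨g, fun y hy => hg y hy⟩

theorem eq_zero_of_eventually_inner_le_sq {y a : E} {C : ℝ}
    (h : ∀ᶠ z in 𝓝 y, ⟪a, z - y⟫ ≤ C * ‖z - y‖ ^ 2) : a = 0 := by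
  have h1 : Tendsto (fun t : ℝ => y + t • a) (𝓝[>] 0) (𝓝 y) := by
    have : Continuous fun t : ℝ => y + t • a := by fun_prop
    simpa using (this.tendsto 0).mono_left nhdsWithin_le_nhds
  have h2 : ∀ᶠ t : ℝ in 𝓝[>] 0, ‖a‖ ^ 2 ≤ C * t * ‖a‖ ^ 2 := by
    filter_upwards [h1.eventually h, self_mem_nhdsWithin] with t ht h0
    have h0 : 0 < t := h0
    rw [add_sub_cancel_left, real_inner_smul_right, norm_smul, Real.norm_of_nonneg h0.le,
      real_inner_self_eq_norm_sq] at ht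
    refine le_of_mul_le_mul_left ?_ h0
    linarith
  have h3 : Tendsto (fun t : ℝ => C * t * ‖a‖ ^ 2) (𝓝[>] 0) (𝓝 0) := by
    have : Continuous fun t : ℝ => C * t * ‖a‖ ^ 2 := by fun_prop
    simpa using (this.tendsto 0).mono_left nhdsWithin_le_nhds
  have h4 := ge_of_tendsto h3 h2
  have h5 : ‖a‖ = 0 := by nlinarith [norm_nonneg a]
  exact norm_eq_zero.1 h5

/-- If `φ` is squeezed between two paraboloids at each point of `S`, then the gradient is Lipschitz
on `S`. -/
theorem norm_sub_le_of_paraboloids {φ : E → ℝ} {g : E → E} {S : Set E} {x₀ : E} {R K : ℝ}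
    (hS : S ⊆ Metric.closedBall x₀ (R / 4))
    (hφ : ∀ y ∈ S, ∀ z ∈ Metric.closedBall x₀ R,
      |φ z - φ y - ⟪g y, z - y⟫| ≤ K * ‖z - y‖ ^ 2) {y₁ y₂ : E} (h₁ : y₁ ∈ S) (h₂ : y₂ ∈ S) :
    ‖g y₁ - g y₂‖ ≤ 6 * K * ‖y₁ - y₂‖ := by
  rcases eq_or_ne y₁ y₂ with rfl | hne
  · simp
  set d := ‖y₁ - y₂‖ with hd
  have hd0 : 0 < d := norm_pos_iff.2 (sub_ne_zero.2 hne)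
  have hy₁ : ‖y₁ - x₀‖ ≤ R / 4 := mem_closedBall_iff_norm.1 (hS h₁)
  have hy₂ : ‖y₂ - x₀‖ ≤ R / 4 := mem_closedBall_iff_norm.1 (hS h₂)
  have hR : 0 ≤ R := by linarith [norm_nonneg (y₁ - x₀)]
  have hdR : d ≤ R / 2 := by
    have : y₁ - y₂ = (y₁ - x₀) - (y₂ - x₀) := by abel
    rw [hd, this]
    exact (norm_sub_le _ _).trans (by linarith)
  have hK := (abs_nonneg _).trans
    (hφ y₂ h₂ y₁ (mem_closedBall_iff_norm.2 (hy₁.trans (by linarith))))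
  set a := g y₁ - g y₂ with ha
  rcases eq_or_ne a 0 with ha0 | ha0
  · rw [ha0, norm_zero]
    rw [← hd] at hK
    have : 0 ≤ K := by
      by_contra hneg
      push Not at hneg
      nlinarith [sq_pos_of_pos hd0]
    positivity
  have ha0' : 0 < ‖a‖ := norm_pos_iff.2 ha0
  set h := (d / ‖a‖) • a with hh
  have hhn : ‖h‖ = d := by
    rw [hh, norm_smul, Real.norm_of_nonneg (by positivity)]
    field_simp
  have hah : ⟪a, h⟫ = d * ‖a‖ := by
    rw [hh, real_inner_smul_right, real_inner_self_eq_norm_sq]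
    field_simp
  have hz : y₁ + h ∈ Metric.closedBall x₀ R := by
    rw [mem_closedBall_iff_norm, show y₁ + h - x₀ = (y₁ - x₀) + h by abel]
    exact (norm_add_le _ _).trans (by linarith)
  have e1 := (abs_le.1 (hφ y₁ h₁ _ hz)).1
  have e2 := (abs_le.1 (hφ y₂ h₂ _ hz)).2
  have e3 := (abs_le.1 (hφ y₂ h₂ y₁
    (mem_closedBall_iff_norm.2 (hy₁.trans (by linarith))))).1
  have hK0 : 0 ≤ K := by
    by_contra hneg
    push Not at hneg
    nlinarith [sq_pos_of_pos hd0]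
  have e4 : ‖y₁ + h - y₂‖ ^ 2 ≤ (2 * d) ^ 2 := by
    gcongr
    rw [show y₁ + h - y₂ = (y₁ - y₂) + h by abel]
    exact (norm_add_le _ _).trans (by linarith)
  have e5 := mul_le_mul_of_nonneg_left e4 hK0
  rw [show y₁ + h - y₂ = (y₁ - y₂) + h by abel, inner_add_right] at e2
  rw [show (y₁ - y₂) + h = y₁ + h - y₂ by abel] at e2
  rw [add_sub_cancel_left, hhn] at e1
  rw [← hd] at e3
  have e6 : ⟪a, h⟫ = ⟪g y₁, h⟫ - ⟪g y₂, h⟫ := by rw [ha, inner_sub_left]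
  have e7 : d * ‖a‖ ≤ d * (6 * K * d) := by rw [← hah, e6]; linarith
  exact le_of_mul_le_mul_left e7 hd0

theorem abs_le_mul_of_abs_sub_le {a : ℕ → ℝ} {c : ℝ} {N : ℕ} (h0 : a 0 = 0)
    (h : ∀ i < N, |a (i + 1) - a i| ≤ c) : |a N| ≤ N * c := by
  have hsum : a N = ∑ i ∈ Finset.range N, (a (i + 1) - a i) := by
    rw [Finset.sum_range_sub, h0, sub_zero]
  rw [hsum]
  refine (Finset.abs_sum_le_sum_abs _ _).trans ?_
  refine (Finset.sum_le_card_nsmul _ _ c fun i hi => h i (Finset.mem_range.1 hi)).trans ?_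
  simp

/-- Second-order Taylor expansion of a function whose gradient, known only on the set `S`, is
differentiable within `S` at a point near which `S` is sufficiently dense. -/
theorem second_order_expansion {φ : E → ℝ} {g : E → E} {S : Set E} {x : E} {K : ℝ} {L : E →L[ℝ] E}
    (hK : 0 ≤ K) (hφ : ∀ᶠ z in 𝓝 x, ∀ y ∈ S, |φ z - φ y - ⟪g y, z - y⟫| ≤ K * ‖z - y‖ ^ 2)
    (hL : HasFDerivWithinAt g L S x)
    (hS : ∀ N : ℕ, 0 < N → ∀ t ∈ Set.Icc (0 : ℝ) 1,
      ∀ᶠ h in 𝓝 (0 : E), (S ∩ Metric.closedBall (x + t • h) (‖h‖ / N)).Nonempty)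
    {c : ℝ} (hc : 0 < c) :
    ∀ᶠ h in 𝓝 (0 : E),
      |φ (x + h) - φ x - ⟪g x, h⟫ - 1 / 2 * ⟪L h, h⟫| ≤ c * ‖h‖ ^ 2 := by
  obtain ⟨N, hN⟩ := exists_nat_gt ((5 * K + 2 * ‖L‖) / (c / 2))
  have hN0 : (0 : ℝ) < N := lt_of_le_of_lt (by positivity) hN
  rw [div_lt_iff₀ (by positivity)] at hN
  have hφ' : ∀ᶠ h in 𝓝 (0 : E), ∀ z, ‖z - x‖ ≤ ‖h‖ →
      ∀ y ∈ S, |φ z - φ y - ⟪g y, z - y⟫| ≤ K * ‖z - y‖ ^ 2 := by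
    obtain ⟨r, hr, hball⟩ := Metric.eventually_nhds_iff.1 hφ
    refine Metric.eventually_nhds_iff.2 ⟨r, hr, fun h hh z hz => hball ?_⟩
    rw [dist_eq_norm]
    rw [dist_zero_right] at hh
    linarith
  have hL' : ∀ᶠ h in 𝓝 (0 : E), ∀ y ∈ S, ‖y - x‖ ≤ 2 * ‖h‖ →
      ‖g y - g x - L (y - x)‖ ≤ c / 4 * ‖y - x‖ := by
    have h1 := Asymptotics.isLittleO_iff.1 (hasFDerivWithinAt_iff_isLittleO.1 hL)
      (show 0 < c / 4 by positivity)
    obtain ⟨r, hr, hball⟩ := Metric.eventually_nhds_iff.1 (eventually_nhdsWithin_iff.1 h1)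
    refine Metric.eventually_nhds_iff.2 ⟨r / 2, by positivity, fun h hh y hy hyx => hball ?_ hy⟩
    rw [dist_eq_norm]
    rw [dist_zero_right] at hh
    linarith
  have hS' : ∀ᶠ h in 𝓝 (0 : E), ∀ i ∈ Finset.range N,
      (S ∩ Metric.closedBall (x + ((i : ℝ) / N) • h) (‖h‖ / N)).Nonempty := by
    rw [Filter.eventually_all_finset]
    intro i hi
    refine hS N (by exact_mod_cast hN0) _ ⟨by positivity, ?_⟩
    rw [div_le_one hN0]
    exact_mod_cast (Finset.mem_range.1 hi).le
  filter_upwards [hφ', hL', hS'] with h h1 h2 h3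
  set a : ℕ → ℝ := fun i => φ (x + ((i : ℝ) / N) • h) - φ x - (i : ℝ) / N * ⟪g x, h⟫
    - ((i : ℝ) / N) ^ 2 / 2 * ⟪L h, h⟫ with ha
  have ha0 : a 0 = 0 := by simp [ha]
  have haN : a N = φ (x + h) - φ x - ⟪g x, h⟫ - 1 / 2 * ⟪L h, h⟫ := by
    simp [ha, div_self hN0.ne']
  have hstep : ∀ i < N, |a (i + 1) - a i| ≤ c * ‖h‖ ^ 2 / N := by
    intro i hi
    set s : ℝ := 1 / N with hs
    have hs0 : 0 < s := by positivity
    set t : ℝ := i / N with ht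
    have ht0 : 0 ≤ t := by positivity
    have hts : ((i + 1 : ℕ) : ℝ) / N = t + s := by push_cast; rw [ht, hs]; ring
    have hts1 : t + s ≤ 1 := by
      rw [← hts, div_le_one hN0]
      exact_mod_cast hi
    obtain ⟨y, hyS, hyB⟩ := h3 i (Finset.mem_range.2 hi)
    set e := x + t • h - y with he
    have hen : ‖e‖ ≤ s * ‖h‖ := by
      rw [he, norm_sub_rev, ← dist_eq_norm]
      exact (Metric.mem_closedBall.1 hyB).trans (le_of_eq (by rw [hs]; ring))
    have hh0 := norm_nonneg h
    have hsh : ‖s • h‖ = s * ‖h‖ := by rw [norm_smul, Real.norm_of_nonneg hs0.le]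
    have hes : ‖e + s • h‖ ≤ 2 * (s * ‖h‖) := (norm_add_le _ _).trans (by rw [hsh]; linarith)
    have hyx : ‖y - x‖ ≤ 2 * ‖h‖ := by
      rw [show y - x = t • h - e by rw [he]; abel]
      refine (norm_sub_le _ _).trans ?_
      rw [norm_smul, Real.norm_of_nonneg ht0]
      nlinarith
    have k1 := h1 (x + t • h) (by
      rw [add_sub_cancel_left, norm_smul, Real.norm_of_nonneg ht0]
      nlinarith) y hyS
    have k2 := h1 (x + (t + s) • h) (by
      rw [add_sub_cancel_left, norm_smul, Real.norm_of_nonneg (by positivity)]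
      nlinarith) y hyS
    rw [← he] at k1
    rw [show x + (t + s) • h - y = e + s • h by rw [he, add_smul]; abel, inner_add_right,
      real_inner_smul_right] at k2
    have k3 : K * ‖e‖ ^ 2 ≤ K * (s * ‖h‖) ^ 2 := by gcongr
    have k4 : K * ‖e + s • h‖ ^ 2 ≤ K * (2 * (s * ‖h‖)) ^ 2 := by gcongr
    have k5 : |⟪g y - g x - L (y - x), h⟫| ≤ c / 4 * (2 * ‖h‖) * ‖h‖ := by
      refine (abs_real_inner_le_norm _ _).trans ?_
      gcongr
      exact (h2 y hyS hyx).trans (by gcongr)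
    have k6 : |⟪L e, h⟫| ≤ ‖L‖ * (s * ‖h‖) * ‖h‖ := by
      refine (abs_real_inner_le_norm _ _).trans ?_
      gcongr
      exact (L.le_opNorm e).trans (by gcongr)
    have k7 : |⟪L h, h⟫| ≤ ‖L‖ * ‖h‖ * ‖h‖ := by
      refine (abs_real_inner_le_norm _ _).trans ?_
      gcongr
      exact L.le_opNorm h
    have k8 : ⟪g y - g x - L (y - x), h⟫ =
        ⟪g y, h⟫ - ⟪g x, h⟫ - t * ⟪L h, h⟫ + ⟪L e, h⟫ := by
      rw [show y - x = t • h - e by rw [he]; abel, map_sub, map_smul, inner_sub_left,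
        inner_sub_left, inner_sub_left, real_inner_smul_left]
      ring
    rw [k8] at k5
    have k9 : a (i + 1) - a i = (φ (x + (t + s) • h) - φ y - (⟪g y, e⟫ + s * ⟪g y, h⟫))
        - (φ (x + t • h) - φ y - ⟪g y, e⟫)
        + s * (⟪g y, h⟫ - ⟪g x, h⟫ - t * ⟪L h, h⟫ + ⟪L e, h⟫) - s * ⟪L e, h⟫
        - s ^ 2 / 2 * ⟪L h, h⟫ := by
      simp only [ha]
      rw [hts]
      ring
    have k10 : (5 * K + 2 * ‖L‖) * s ≤ c / 2 := by
      rw [hs, mul_one_div, div_le_iff₀ hN0]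
      linarith
    have b1 := abs_le.1 (k1.trans k3)
    have b2 := abs_le.1 (k2.trans k4)
    have b3 := abs_le.1 k5
    have b4 := abs_le.1 k6
    have b5 := abs_le.1 k7
    have b6 : s * ‖h‖ ^ 2 * ((5 * K + 2 * ‖L‖) * s) ≤ s * ‖h‖ ^ 2 * (c / 2) := by gcongr
    have hLs : 0 ≤ s ^ 2 * ‖L‖ * ‖h‖ ^ 2 := by positivity
    rw [k9, show c * ‖h‖ ^ 2 / N = c * ‖h‖ ^ 2 * s by rw [hs]; ring, abs_le]
    have c3 := mul_le_mul_of_nonneg_left b3.1 hs0.le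
    have c3' := mul_le_mul_of_nonneg_left b3.2 hs0.le
    have c4 := mul_le_mul_of_nonneg_left b4.1 hs0.le
    have c4' := mul_le_mul_of_nonneg_left b4.2 hs0.le
    have hs2 : 0 ≤ s ^ 2 / 2 := by positivity
    have c5 := mul_le_mul_of_nonneg_left b5.1 hs2
    have c5' := mul_le_mul_of_nonneg_left b5.2 hs2
    constructor
    · linarith [b1.2, b2.1]
    · linarith [b1.1, b2.2]
  have := abs_le_mul_of_abs_sub_le ha0 hstep
  rw [haN] at this
  refine this.trans (le_of_eq ?_)
  field_simp

/-- At almost every point `x` of a set `S`, the set `S` meets every ball whose radius is a fixed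
fraction of `‖h‖` centred on the segment from `x` to `x + h`, provided `h` is small. -/
theorem ae_eventually_inter_closedBall_nonempty [FiniteDimensional ℝ E] [MeasurableSpace E]
    [BorelSpace E] (μ : Measure E) [μ.IsAddHaarMeasure] (S : Set E) :
    ∀ᵐ x ∂μ.restrict S, ∀ N : ℕ, 0 < N → ∀ t ∈ Set.Icc (0 : ℝ) 1,
      ∀ᶠ h in 𝓝[≠] (0 : E), (S ∩ Metric.closedBall (x + t • h) (‖h‖ / N)).Nonempty := by
  rw [ae_all_iff]
  intro N
  filter_upwards [IsUnifLocDoublingMeasure.ae_tendsto_measure_inter_div μ S (N : ℝ)]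
    with x hx hN t ht
  have hN0 : (0 : ℝ) < N := by exact_mod_cast hN
  have h1 := hx (l := 𝓝[≠] (0 : E)) (fun h => x + t • h) (fun h => ‖h‖ / N) (by
      refine tendsto_nhdsWithin_iff.2 ⟨?_, ?_⟩
      · have : Continuous fun h : E => ‖h‖ / N := by fun_prop
        simpa using (this.tendsto 0).mono_left nhdsWithin_le_nhds
      · filter_upwards [self_mem_nhdsWithin] with h hh
        exact div_pos (norm_pos_iff.2 hh) hN0) (by
      refine Eventually.of_forall fun h => ?_
      rw [mul_div_cancel₀ _ hN0.ne', mem_closedBall_iff_norm, sub_add_cancel_left, norm_neg,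
        norm_smul, Real.norm_of_nonneg ht.1]
      exact mul_le_of_le_one_left (norm_nonneg h) ht.2)
  have h2 := h1.eventually_ne one_ne_zero
  filter_upwards [h2] with h hh
  by_contra hempty
  rw [Set.not_nonempty_iff_eq_empty] at hempty
  rw [hempty] at hh
  simp at hh

theorem nonpos_of_quadratic_eventually_le {q : E → ℝ} (hq : ∀ (t : ℝ) h, q (t • h) = t ^ 2 * q h)
    (hle : ∀ c : ℝ, 0 < c → ∀ᶠ h in 𝓝 (0 : E), q h ≤ c * ‖h‖ ^ 2) (h : E) : q h ≤ 0 := by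
  have hc : ∀ c : ℝ, 0 < c → q h ≤ c * ‖h‖ ^ 2 := by
    intro c hc
    have h1 : Tendsto (fun t : ℝ => t • h) (𝓝[>] 0) (𝓝 0) := by
      have : Continuous fun t : ℝ => t • h := by fun_prop
      simpa using (this.tendsto 0).mono_left nhdsWithin_le_nhds
    obtain ⟨t, ht, ht0⟩ := ((h1.eventually (hle c hc)).and self_mem_nhdsWithin).exists
    have ht0 : 0 < t := ht0
    rw [hq, norm_smul, mul_pow, Real.norm_eq_abs, sq_abs] at ht
    refine le_of_mul_le_mul_left ?_ (pow_pos ht0 2)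
    linarith
  have h3 : Tendsto (fun c : ℝ => c * ‖h‖ ^ 2) (𝓝[>] 0) (𝓝 0) := by
    have : Continuous fun c : ℝ => c * ‖h‖ ^ 2 := by fun_prop
    simpa using (this.tendsto 0).mono_left nhdsWithin_le_nhds
  refine ge_of_tendsto h3 ?_
  filter_upwards [self_mem_nhdsWithin] with c h0
  exact hc c h0

/-- If the sum of two semiconvex functions is touched strictly from above by a quadratic
polynomial at `x₀`, then arbitrarily close to `x₀` there is a point at which both functions have a
second-order Taylor expansion, with gradients almost summing to that of the polynomial and with
the sum of the Hessians bounded by that of the polynomial. -/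
theorem exists_common_second_order_point [FiniteDimensional ℝ E] {u v : E → ℝ} {g₁ g₂ : E → E}
    {x₀ p : E} {R ε lam : ℝ} {M : E →L[ℝ] E} (hlam : 0 ≤ lam) (hR : 0 < R) (hε : 0 < ε)
    (hM : ∀ a b, ⟪M a, b⟫ = ⟪a, M b⟫)
    (hu : ∀ y ∈ Metric.closedBall x₀ R, ∀ z ∈ Metric.closedBall x₀ R,
      u y + ⟪g₁ y, z - y⟫ - lam / 2 * ‖z - y‖ ^ 2 ≤ u z)
    (hv : ∀ y ∈ Metric.closedBall x₀ R, ∀ z ∈ Metric.closedBall x₀ R,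
      v y + ⟪g₂ y, z - y⟫ - lam / 2 * ‖z - y‖ ^ 2 ≤ v z)
    (hcont : ContinuousOn (fun z => u z + v z) (Metric.closedBall x₀ R))
    (hmax : ∀ z ∈ Metric.closedBall x₀ R, u z + v z ≤
      u x₀ + v x₀ + ⟪p, z - x₀⟫ + 1 / 2 * ⟪M (z - x₀), z - x₀⟫ - ε * ‖z - x₀‖ ^ 2)
    {ρ : ℝ} (hρ : 0 < ρ) :
    ∃ y ∈ Metric.closedBall x₀ ρ, ∃ L₁ L₂ : E →L[ℝ] E,
      y ∈ Metric.closedBall x₀ R ∧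
      (∀ c : ℝ, 0 < c → ∀ᶠ h in 𝓝 (0 : E),
        |u (y + h) - u y - ⟪g₁ y, h⟫ - 1 / 2 * ⟪L₁ h, h⟫| ≤ c * ‖h‖ ^ 2) ∧
      (∀ c : ℝ, 0 < c → ∀ᶠ h in 𝓝 (0 : E),
        |v (y + h) - v y - ⟪g₂ y, h⟫ - 1 / 2 * ⟪L₂ h, h⟫| ≤ c * ‖h‖ ^ 2) ∧
      ‖g₁ y + g₂ y - p - M (y - x₀)‖ ≤ ρ ∧
      ∀ h, ⟪L₁ h, h⟫ + ⟪L₂ h, h⟫ ≤ ⟪M h, h⟫ := by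
  borelize E
  set B := Metric.closedBall x₀ R with hB
  set σ := min ρ (ε * min ρ (R / 4)) with hσ
  have hσ0 : 0 < σ := by positivity
  have hσρ : σ ≤ ρ := min_le_left _ _
  have hσε : σ ≤ ε * min ρ (R / 4) := min_le_right _ _
  set f : E → ℝ := fun z => u z + v z - ⟪p, z - x₀⟫ - 1 / 2 * ⟪M (z - x₀), z - x₀⟫ with hf
  set S : Set E := {y | y ∈ B ∧ ∃ η : E, ‖η‖ ≤ σ ∧ ∀ z ∈ B, f z - ⟪η, z⟫ ≤ f y - ⟪η, y⟫} with hSdef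
  have hx₀ : x₀ ∈ B := Metric.mem_closedBall_self hR.le
  have hSsmall : ∀ y ∈ S, ‖y - x₀‖ ≤ min ρ (R / 4) := by
    rintro y ⟨hyB, η, hη, hmaxη⟩
    have h1 := hmaxη x₀ hx₀
    have h2 := hmax y hyB
    have h3 : ⟪η, x₀ - y⟫ ≤ σ * ‖y - x₀‖ := by
      rw [norm_sub_rev y]
      exact (real_inner_le_norm _ _).trans (by gcongr)
    simp only [hf, sub_self, inner_zero_right, map_zero, mul_zero, sub_zero] at h1
    rw [inner_sub_right] at h3
    by_contra hlt
    push Not at hlt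
    have h5 : 0 < min ρ (R / 4) := by positivity
    have h4 : ε * ‖y - x₀‖ * ‖y - x₀‖ ≤ ε * min ρ (R / 4) * ‖y - x₀‖ := by
      have := mul_le_mul_of_nonneg_right hσε (norm_nonneg (y - x₀))
      linarith
    have h6 := le_of_mul_le_mul_right h4 (h5.trans hlt)
    have h7 := le_of_mul_le_mul_left h6 hε
    linarith
  have hSR : S ⊆ Metric.closedBall x₀ (R / 4) := fun y hy =>
    mem_closedBall_iff_norm.2 ((hSsmall y hy).trans (min_le_right _ _))
  have hSnhds : ∀ y ∈ S, B ∈ 𝓝 y := fun y hy =>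
    Metric.closedBall_mem_nhds_of_mem (Metric.mem_ball.2
      ((Metric.mem_closedBall.1 (hSR hy)).trans_lt (by linarith)))
  have hcontact : ∀ y ∈ S, ∀ η : E, (∀ z ∈ B, f z - ⟪η, z⟫ ≤ f y - ⟪η, y⟫) → ∀ z ∈ B,
      u z + v z ≤ u y + v y + ⟪η + p + M (y - x₀), z - y⟫ + 1 / 2 * ⟪M (z - y), z - y⟫ := by
    intro y hy η hη z hz
    have h1 := hη z hz
    simp only [hf] at h1
    have h2 : ⟪M (z - x₀), z - x₀⟫ = ⟪M (y - x₀), y - x₀⟫ + 2 * ⟪M (y - x₀), z - y⟫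
        + ⟪M (z - y), z - y⟫ := by
      rw [show z - x₀ = (y - x₀) + (z - y) by abel, map_add, inner_add_left, inner_add_right,
        inner_add_right, hM (z - y) (y - x₀), real_inner_comm (M (y - x₀)) (z - y)]
      ring
    rw [inner_add_left, inner_add_left]
    have h3 : ⟪p, z - x₀⟫ = ⟪p, y - x₀⟫ + ⟪p, z - y⟫ := by
      rw [← inner_add_right]; congr 1; abel
    have h4 : ⟪η, z - y⟫ = ⟪η, z⟫ - ⟪η, y⟫ := inner_sub_right _ _ _
    rw [h2, h3] at h1
    linarith
  have hMle : ∀ h : E, ⟪M h, h⟫ ≤ ‖M‖ * ‖h‖ ^ 2 := fun h => by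
    rw [sq, ← mul_assoc]
    refine (real_inner_le_norm _ _).trans ?_
    gcongr
    exact M.le_opNorm h
  have hgrad : ∀ y ∈ S, ∀ η : E, (∀ z ∈ B, f z - ⟪η, z⟫ ≤ f y - ⟪η, y⟫) →
      g₁ y + g₂ y = η + p + M (y - x₀) := by
    intro y hy η hη
    rw [← sub_eq_zero]
    refine eq_zero_of_eventually_inner_le_sq (y := y) (C := lam + ‖M‖ / 2) ?_
    filter_upwards [hSnhds y hy] with z hz
    have h1 := hcontact y hy η hη z hz
    have h2 := hu y hy.1 z hz
    have h3 := hv y hy.1 z hz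
    have h4 := hMle (z - y)
    rw [inner_sub_left, inner_add_left]
    linarith
  set K := lam + ‖M‖ with hKdef
  have hM0 : 0 ≤ ‖M‖ := norm_nonneg M
  have hK : 0 ≤ K := by positivity
  have hupper : ∀ y ∈ S, ∀ z ∈ B, u z + v z ≤
      u y + v y + ⟪g₁ y, z - y⟫ + ⟪g₂ y, z - y⟫ + 1 / 2 * ⟪M (z - y), z - y⟫ := by
    intro y hy z hz
    obtain ⟨η, -, hη⟩ := hy.2
    have h1 := hcontact y hy η hη z hz
    rw [← hgrad y hy η hη, inner_add_left] at h1
    linarith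
  have hparu : ∀ y ∈ S, ∀ z ∈ B, |u z - u y - ⟪g₁ y, z - y⟫| ≤ K * ‖z - y‖ ^ 2 := by
    intro y hy z hz
    have h1 := hupper y hy z hz
    have h2 := hu y hy.1 z hz
    have h3 := hv y hy.1 z hz
    have h4 := hMle (z - y)
    have h5 : 0 ≤ ‖M‖ * ‖z - y‖ ^ 2 := by positivity
    have h6 : 0 ≤ lam * ‖z - y‖ ^ 2 := by positivity
    rw [abs_le]
    constructor <;> linarith
  have hparv : ∀ y ∈ S, ∀ z ∈ B, |v z - v y - ⟪g₂ y, z - y⟫| ≤ K * ‖z - y‖ ^ 2 := by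
    intro y hy z hz
    have h1 := hupper y hy z hz
    have h2 := hu y hy.1 z hz
    have h3 := hv y hy.1 z hz
    have h4 := hMle (z - y)
    have h5 : 0 ≤ ‖M‖ * ‖z - y‖ ^ 2 := by positivity
    have h6 : 0 ≤ lam * ‖z - y‖ ^ 2 := by positivity
    rw [abs_le]
    constructor <;> linarith
  have hLip₁ : LipschitzOnWith (Real.toNNReal (6 * K)) g₁ S :=
    LipschitzOnWith.of_dist_le_mul fun y hy z hz => by
      rw [dist_eq_norm, dist_eq_norm, Real.coe_toNNReal _ (by positivity)]
      exact norm_sub_le_of_paraboloids hSR hparu hy hz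
  have hLip₂ : LipschitzOnWith (Real.toNNReal (6 * K)) g₂ S :=
    LipschitzOnWith.of_dist_le_mul fun y hy z hz => by
      rw [dist_eq_norm, dist_eq_norm, Real.coe_toNNReal _ (by positivity)]
      exact norm_sub_le_of_paraboloids hSR hparv hy hz
  have hLip : LipschitzOnWith (Real.toNNReal (6 * K) + Real.toNNReal (6 * K) + ‖M‖₊)
      (fun y => g₁ y + g₂ y - (p + M (y - x₀))) S := by
    refine (hLip₁.add hLip₂).sub (LipschitzWith.lipschitzOnWith ?_)
    refine LipschitzWith.of_dist_le_mul fun y z => ?_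
    rw [dist_eq_norm, dist_eq_norm, add_sub_add_left_eq_sub, ← map_sub, sub_sub_sub_cancel_right]
    exact M.le_opNorm _
  have himage : Metric.closedBall 0 σ ⊆ (fun y => g₁ y + g₂ y - (p + M (y - x₀))) '' S := by
    intro η hη
    have hfc : ContinuousOn (fun z => f z - ⟪η, z⟫) B := by
      refine ContinuousOn.sub (ContinuousOn.sub (hcont.sub ?_) ?_) ?_ <;>
      exact Continuous.continuousOn (by fun_prop)
    obtain ⟨y, hyB, hy⟩ := (isCompact_closedBall x₀ R).exists_isMaxOn ⟨x₀, hx₀⟩ hfc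
    have hyS : y ∈ S := ⟨hyB, η, by simpa using hη, fun z hz => hy hz⟩
    refine ⟨y, hyS, ?_⟩
    simp only [hgrad y hyS η fun z hz => hy hz]
    abel
  set μ : Measure E := Measure.hausdorffMeasure (Module.finrank ℝ E) with hμ
  have hSpos : μ S ≠ 0 := by
    intro h0
    have h1 := hLip.hausdorffMeasure_image_le (d := Module.finrank ℝ E) (by positivity)
    rw [← hμ, h0, mul_zero] at h1
    have h2 := (measure_mono himage).trans h1
    have h3 := Metric.measure_closedBall_pos μ (0 : E) hσ0
    exact absurd h2 (not_le.2 h3)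
  have hgood : ∀ᵐ y ∂μ.restrict S, (y ∈ S → DifferentiableWithinAt ℝ g₁ S y) ∧
      (y ∈ S → DifferentiableWithinAt ℝ g₂ S y) ∧
      ∀ N : ℕ, 0 < N → ∀ t ∈ Set.Icc (0 : ℝ) 1,
        ∀ᶠ h in 𝓝[≠] (0 : E), (S ∩ Metric.closedBall (y + t • h) (‖h‖ / N)).Nonempty := by
    filter_upwards [ae_restrict_of_ae (hLip₁.ae_differentiableWithinAt_of_mem (μ := μ)),
      ae_restrict_of_ae (hLip₂.ae_differentiableWithinAt_of_mem (μ := μ)),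
      ae_eventually_inter_closedBall_nonempty μ S] with y h1 h2 h3
    exact ⟨h1, h2, h3⟩
  obtain ⟨y, hyS, hd₁, hd₂, hdens⟩ := Measure.exists_mem_of_measure_ne_zero_of_ae hSpos hgood
  have hdens' : ∀ N : ℕ, 0 < N → ∀ t ∈ Set.Icc (0 : ℝ) 1,
      ∀ᶠ h in 𝓝 (0 : E), (S ∩ Metric.closedBall (y + t • h) (‖h‖ / N)).Nonempty := by
    intro N hN t ht
    filter_upwards [eventually_nhdsWithin_iff.1 (hdens N hN t ht)] with h hh
    rcases eq_or_ne h 0 with rfl | hne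
    · exact ⟨y, hyS, by simp⟩
    · exact hh hne
  have hexp₁ := fun c hc => second_order_expansion (c := c) hK
    (by filter_upwards [hSnhds y hyS] with z hz w hw using hparu w hw z hz)
    (hd₁ hyS).hasFDerivWithinAt hdens' hc
  have hexp₂ := fun c hc => second_order_expansion (c := c) hK
    (by filter_upwards [hSnhds y hyS] with z hz w hw using hparv w hw z hz)
    (hd₂ hyS).hasFDerivWithinAt hdens' hc
  refine ⟨y, mem_closedBall_iff_norm.2 ((hSsmall y hyS).trans (min_le_left _ _)), _, _, hyS.1,
    hexp₁, hexp₂, ?_, ?_⟩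
  · obtain ⟨η, hησ, hη⟩ := hyS.2
    rw [hgrad y hyS η hη, show η + p + M (y - x₀) - p - M (y - x₀) = η by abel]
    exact hησ.trans hσρ
  · set L₁ := fderivWithin ℝ g₁ S y
    set L₂ := fderivWithin ℝ g₂ S y
    intro h
    rw [← sub_nonpos]
    refine nonpos_of_quadratic_eventually_le
      (q := fun h => ⟪L₁ h, h⟫ + ⟪L₂ h, h⟫ - ⟪M h, h⟫) ?_ ?_ h
    · intro t h
      simp only [map_smul, real_inner_smul_left, real_inner_smul_right]
      ring
    · intro c hc
      have hBy : ∀ᶠ h in 𝓝 (0 : E), y + h ∈ B := by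
        have : Tendsto (fun h : E => y + h) (𝓝 0) (𝓝 y) := by
          simpa using (continuous_const_add y).tendsto 0
        exact this.eventually (hSnhds y hyS)
      filter_upwards [hexp₁ (c / 4) (by positivity), hexp₂ (c / 4) (by positivity), hBy]
        with h h1 h2 h3
      have h4 := hupper y hyS _ h3
      rw [add_sub_cancel_left] at h4
      have h5 := (abs_le.1 h1).1
      have h6 := (abs_le.1 h2).1
      linarith
end

theorem quad_eq_inner {n : ℕ} (A : Matrix (Fin n) (Fin n) ℝ) (v : EuclideanSpace ℝ (Fin n)) :
    quad A v = ⟪Matrix.toEuclideanCLM (𝕜 := ℝ) A v, v⟫ := by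
  rw [real_inner_comm, Matrix.inner_toEuclideanCLM]
  simp only [quad, dotProduct, Matrix.mulVec, Finset.mul_sum]
  exact Finset.sum_congr rfl fun i _ => Finset.sum_congr rfl fun j _ => by ring

theorem quad_eq_dotProduct {n : ℕ} (A : Matrix (Fin n) (Fin n) ℝ) (v : EuclideanSpace ℝ (Fin n)) :
    quad A v = v.ofLp ⬝ᵥ A.mulVec v.ofLp := by
  rw [quad_eq_inner, real_inner_comm, Matrix.inner_toEuclideanCLM]

theorem quad_add {n : ℕ} (A B : Matrix (Fin n) (Fin n) ℝ) (v : EuclideanSpace ℝ (Fin n)) :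
    quad (A + B) v = quad A v + quad B v := by
  simp only [quad_eq_dotProduct, Matrix.add_mulVec, dotProduct_add]

theorem quad_sub {n : ℕ} (A B : Matrix (Fin n) (Fin n) ℝ) (v : EuclideanSpace ℝ (Fin n)) :
    quad (A - B) v = quad A v - quad B v := by
  simp only [quad_eq_dotProduct, Matrix.sub_mulVec, dotProduct_sub]

theorem quad_smul_one {n : ℕ} (c : ℝ) (v : EuclideanSpace ℝ (Fin n)) :
    quad (c • (1 : Matrix (Fin n) (Fin n) ℝ)) v = c * ‖v‖ ^ 2 := by
  rw [quad_eq_inner, map_smul, map_one, ← real_inner_self_eq_norm_sq, ← real_inner_smul_left]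
  rfl

theorem exists_isSymm_quad_eq {n : ℕ}
    (L : EuclideanSpace ℝ (Fin n) →L[ℝ] EuclideanSpace ℝ (Fin n)) :
    ∃ A : Matrix (Fin n) (Fin n) ℝ, A.IsSymm ∧ ∀ v, quad A v = ⟪L v, v⟫ := by
  obtain ⟨B, rfl⟩ : ∃ B, Matrix.toEuclideanCLM (𝕜 := ℝ) (n := Fin n) B = L :=
    (Matrix.toEuclideanCLM (𝕜 := ℝ) (n := Fin n)).surjective L
  refine ⟨(1 / 2 : ℝ) • (B + B.transpose), ?_, fun v => ?_⟩
  · ext i j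
    simp [add_comm, mul_add]
  · rw [← quad_eq_inner, quad_eq_dotProduct, quad_eq_dotProduct, Matrix.smul_mulVec,
      Matrix.add_mulVec, dotProduct_smul, dotProduct_add, Matrix.mulVec_transpose,
      dotProduct_comm v.ofLp (Matrix.vecMul _ _), ← Matrix.dotProduct_mulVec, smul_eq_mul]
    ring

theorem posSemidef_of_quad_nonneg {n : ℕ} {P : Matrix (Fin n) (Fin n) ℝ} (hP : P.IsSymm)
    (h : ∀ v, 0 ≤ quad P v) : P.PosSemidef := by
  refine Matrix.PosSemidef.of_dotProduct_mulVec_nonneg ?_ fun x => ?_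
  · rw [Matrix.IsHermitian, Matrix.conjTranspose_eq_transpose_of_trivial]
    exact hP
  · have := h (WithLp.toLp 2 x)
    rwa [quad_eq_dotProduct] at this

/-- A second-order Taylor expansion yields an upper contact jet after increasing the Hessian. -/
theorem UpperContactJet.of_expansion {n : ℕ} {w : EuclideanSpace ℝ (Fin n) → ℝ}
    {y g : EuclideanSpace ℝ (Fin n)} {A : Matrix (Fin n) (Fin n) ℝ} {ε : ℝ}
    (h : ∀ᶠ h in 𝓝 (0 : EuclideanSpace ℝ (Fin n)),
      |w (y + h) - w y - ⟪g, h⟫ - 1 / 2 * quad A h| ≤ ε / 2 * ‖h‖ ^ 2) :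
    UpperContactJet w y g (A + ε • (1 : Matrix (Fin n) (Fin n) ℝ)) := by
  have ht : Tendsto (fun z => z - y) (𝓝 y) (𝓝 0) := by
    simpa using (continuous_sub_right y).tendsto y
  filter_upwards [ht.eventually h] with z hz
  rw [add_sub_cancel] at hz
  rw [quad_add, quad_smul_one]
  linarith [(abs_le.1 hz).2]

/-- The fibrewise sum of two sets of jets. -/
def fibreSum {n : ℕ} (F G : Set (Jet n)) : Set (Jet n) :=
  {z : Jet n | ∃ (r s : ℝ) (p q : EuclideanSpace ℝ (Fin n)) (A B : Matrix (Fin n) (Fin n) ℝ),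
    (z.1, r, p, A) ∈ F ∧ (z.1, s, q, B) ∈ G ∧
    z.2.1 = r + s ∧ z.2.2.1 = p + q ∧ z.2.2.2 = A + B}

theorem Positivity.fibreSum {n : ℕ} {F : Set (Jet n)} (hF : Positivity F) (G : Set (Jet n)) :
    Positivity (fibreSum F G) := by
  rintro x t m C P ⟨r, s, p, q, A, B, hA, hB, h1, h2, h3⟩ hP
  refine ⟨r, s, p, q, A + P, B, hF _ _ _ _ _ hA hP, hB, h1, h2, ?_⟩
  simp only at h3 ⊢
  rw [h3]
  abel

theorem Positivity.closure {n : ℕ} {F : Set (Jet n)} (hF : Positivity F) :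
    Positivity (closure F) := by
  intro x r p A P hA hP
  have hc : Continuous fun z : Jet n => ((z.1, z.2.1, z.2.2.1, z.2.2.2 + P) : Jet n) := by
    fun_prop
  exact (map_mem_closure hc hA fun z hz => hF z.1 z.2.1 z.2.2.1 z.2.2.2 P hz hP :)

theorem mem_closure_fibreSum_of_upperContactJet {n : ℕ} {F G : Set (Jet n)} (hFp : Positivity F)
    {U : Set (EuclideanSpace ℝ (Fin n))} (hU : IsOpen U)
    {u v : EuclideanSpace ℝ (Fin n) → ℝ} {lam : ℝ} (hlam : 0 ≤ lam)
    (hqcu : QCOn lam U u) (hqcv : QCOn lam U v) (huv : ContinuousOn (fun y => u y + v y) U)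
    (hu : Subharm F U u) (hv : Subharm G U v) {x p : EuclideanSpace ℝ (Fin n)} (hx : x ∈ U)
    {A : Matrix (Fin n) (Fin n) ℝ} (hA : A.IsSymm)
    (hp : UpperContactJet (fun y => u y + v y) x p A) {ε : ℝ} (hε : 0 < ε) :
    (x, u x + v x, p, A + (4 * ε) • (1 : Matrix (Fin n) (Fin n) ℝ)) ∈
      closure (fibreSum F G) := by
  obtain ⟨g₁, hg₁⟩ := hqcu.exists_lower_paraboloid hU
  obtain ⟨g₂, hg₂⟩ := hqcv.exists_lower_paraboloid hU
  obtain ⟨R, hR, hball⟩ := Metric.nhds_basis_closedBall.mem_iff.1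
    (Filter.inter_mem (hU.mem_nhds hx) hp)
  have hBU : Metric.closedBall x R ⊆ U := fun z hz => (hball hz).1
  set A' := A + (2 * ε) • (1 : Matrix (Fin n) (Fin n) ℝ) with hA'
  have hA's : A'.IsSymm := hA.add (Matrix.isSymm_one.smul _)
  set M := Matrix.toEuclideanCLM (𝕜 := ℝ) A' with hM
  have hMsymm : ∀ a b, ⟪M a, b⟫ = ⟪a, M b⟫ := by
    intro a b
    rw [real_inner_comm, hM, Matrix.inner_toEuclideanCLM, Matrix.inner_toEuclideanCLM,
      Matrix.dotProduct_mulVec, ← Matrix.mulVec_transpose, hA's, dotProduct_comm]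
  have hkey : ∀ k : ℕ, ∃ z : Jet n, z ∈ fibreSum F G ∧
      ∃ y ∈ Metric.closedBall x (1 / ((k : ℝ) + 1)), ∃ e : EuclideanSpace ℝ (Fin n),
        ‖e‖ ≤ 1 / ((k : ℝ) + 1) ∧ z = (y, u y + v y, p + M (y - x) + e,
          A + (4 * ε) • (1 : Matrix (Fin n) (Fin n) ℝ)) := by
    intro k
    obtain ⟨y, hy, L₁, L₂, hyB, h1, h2, h3, h4⟩ := exists_common_second_order_point
      (u := u) (v := v) (g₁ := g₁) (g₂ := g₂) (x₀ := x) (p := p) hlam hR hε hMsymm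
      (fun y hy z hz => hg₁ y (hBU hy) z (hBU hz)) (fun y hy z hz => hg₂ y (hBU hy) z (hBU hz))
      (huv.mono hBU) (by
        intro z hz
        have h := (hball hz).2
        simp only [Set.mem_ofPred_eq] at h
        rw [← quad_eq_inner, hA', quad_add, quad_smul_one]
        linarith) (ρ := 1 / ((k : ℝ) + 1)) (by positivity)
    obtain ⟨H₁, hH₁, hq₁⟩ := exists_isSymm_quad_eq L₁
    obtain ⟨H₂, hH₂, hq₂⟩ := exists_isSymm_quad_eq L₂
    have hyU := hBU hyB
    have hjF := hu y hyU (g₁ y) _ (hH₁.add (Matrix.isSymm_one.smul ε))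
      (UpperContactJet.of_expansion (by simpa only [hq₁] using h1 (ε / 2) (by positivity)))
    have hjG := hv y hyU (g₂ y) _ (hH₂.add (Matrix.isSymm_one.smul ε))
      (UpperContactJet.of_expansion (by simpa only [hq₂] using h2 (ε / 2) (by positivity)))
    have hP : (A' - (H₁ + H₂)).PosSemidef := by
      refine posSemidef_of_quad_nonneg (hA's.sub (hH₁.add hH₂)) fun h => ?_
      rw [quad_sub, quad_add H₁, hq₁, hq₂, quad_eq_inner, sub_nonneg]
      exact h4 h
    refine ⟨_, ⟨u y, v y, g₁ y, g₂ y, _, _, hFp _ _ _ _ _ hjF hP, hjG, rfl, ?_, ?_⟩, y, hy,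
      g₁ y + g₂ y - p - M (y - x), h3, rfl⟩
    · simp only
      abel
    · simp only [hA']
      rw [show (4 * ε) = 2 * ε + ε + ε by ring, add_smul, add_smul]
      abel
  choose z hz y hy e he hze using hkey
  have hk : Tendsto (fun k : ℕ => 1 / ((k : ℝ) + 1)) atTop (𝓝 0) :=
    tendsto_one_div_add_atTop_nhds_zero_nat
  have hylim : Tendsto y atTop (𝓝 x) := by
    rw [tendsto_iff_dist_tendsto_zero]
    exact squeeze_zero (fun _ => dist_nonneg) (fun k => Metric.mem_closedBall.1 (hy k)) hk
  have helim : Tendsto e atTop (𝓝 0) := squeeze_zero_norm he hk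
  have hwlim : Tendsto (fun k => u (y k) + v (y k)) atTop (𝓝 (u x + v x)) :=
    (huv.continuousAt (hU.mem_nhds hx)).tendsto.comp hylim
  have hplim : Tendsto (fun k => p + M (y k - x) + e k) atTop (𝓝 p) := by
    have h1 : Tendsto (fun k => M (y k - x)) atTop (𝓝 (M (x - x))) :=
      (M.continuous.tendsto _).comp (hylim.sub_const x)
    simpa using (h1.const_add p).add helim
  refine mem_closure_of_tendsto (f := z) (b := atTop) ?_ (Eventually.of_forall hz)
  rw [show z = _ from funext hze]
  exact hylim.prodMk_nhds (hwlim.prodMk_nhds (hplim.prodMk_nhds tendsto_const_nhds))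

theorem QCOn.continuousOn {n : ℕ} {lam : ℝ} {U : Set (EuclideanSpace ℝ (Fin n))}
    {w : EuclideanSpace ℝ (Fin n) → ℝ} (hw : QCOn lam U w) (hU : IsOpen U) :
    ContinuousOn w U := by
  have h1 : ContinuousOn (fun x : EuclideanSpace ℝ (Fin n) => lam / 2 * ‖x‖ ^ 2) U :=
    Continuous.continuousOn (by fun_prop)
  exact ((ConvexOn.continuousOn hU hw).sub h1).congr fun x _ => by simp

/-- (Basic Addition Theorem) If `F, G` are primitive subequations on `U` and `H` is the
closure of the fibrewise sum `F + G`, then `H` is a primitive subequation, and the sum of a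
quasi-convex `F`-subharmonic and a quasi-convex `G`-subharmonic function is
`H`-subharmonic. -/
theorem stmt_16 {n : ℕ} (F G : Set (Jet n))
    (hFc : IsClosed F) (hFp : Positivity F) (hGc : IsClosed G) (hGp : Positivity G)
    (U : Set (EuclideanSpace ℝ (Fin n))) (hU : IsOpen U)
    (u v : EuclideanSpace ℝ (Fin n) → ℝ) (lam : ℝ) (hlam : 0 ≤ lam)
    (hqcu : QCOn lam U u) (hqcv : QCOn lam U v)
    (hu : Subharm F U u) (hv : Subharm G U v) :
    Positivity (closure {z : Jet n |
      ∃ (r s : ℝ) (p q : EuclideanSpace ℝ (Fin n)) (A B : Matrix (Fin n) (Fin n) ℝ),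
        (z.1, r, p, A) ∈ F ∧ (z.1, s, q, B) ∈ G ∧
        z.2.1 = r + s ∧ z.2.2.1 = p + q ∧ z.2.2.2 = A + B}) ∧
    Subharm (closure {z : Jet n |
      ∃ (r s : ℝ) (p q : EuclideanSpace ℝ (Fin n)) (A B : Matrix (Fin n) (Fin n) ℝ),
        (z.1, r, p, A) ∈ F ∧ (z.1, s, q, B) ∈ G ∧
        z.2.1 = r + s ∧ z.2.2.1 = p + q ∧ z.2.2.2 = A + B}) U
      (fun y => u y + v y) := by
  refine ⟨(hFp.fibreSum G).closure, fun x hx p A hA hp => ?_⟩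
  have huv : ContinuousOn (fun y => u y + v y) U :=
    (hqcu.continuousOn hU).add (hqcv.continuousOn hU)
  have hlim : Tendsto
      (fun ε : ℝ => ((x, u x + v x, p, A + (4 * ε) • (1 : Matrix (Fin n) (Fin n) ℝ)) : Jet n))
      (𝓝[>] 0) (𝓝 (x, u x + v x, p, A)) := by
    have hc : Continuous fun ε : ℝ =>
        ((x, u x + v x, p, A + (4 * ε) • (1 : Matrix (Fin n) (Fin n) ℝ)) : Jet n) := by
      fun_prop
    simpa using (hc.tendsto 0).mono_left nhdsWithin_le_nhds
  refine isClosed_closure.mem_of_tendsto hlim ?_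
  filter_upwards [self_mem_nhdsWithin] with ε hε
  exact mem_closure_fibreSum_of_upperContactJet hFp hU hlam hqcu hqcv huv hu hv hx hA hp hε
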